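/- For all η, η′ in the open forward light cone Γ₊ = {x ∈ ℝ⁴ : x₀ > |x⃗|} and every Schwartz function g on ℝ⁸ = ℝ⁴ × ℝ⁴, the limit as t → 0⁺ of ∫_{ℝ⁴×ℝ⁴} f₂(x − i t η, y − i t η′) g(x, y) dx dy exists and equals Δ₊⁽²⁾(g) := (2π)^{−6} ∫_{ℝ³×ℝ³} (1/(4ω(k)ω(p))) ( ∫_{ℝ⁸} g(x, y) e^{−i(ω(k) x₀ + ω(p) y₀) + i(⟨k, x⃗⟩ + ⟨p, y⃗⟩)} dx dy ) dk dp. That is, the tensor product Δ₊⁽²⁾ of two two-point functions is the boundary value, in the sense of tempered distributions, of the analytic function f₂. -/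

import Mathlib

open MeasureTheory

/-- The on-shell energy `ω(k) = √(|k|² + m²)` for `k ∈ ℝ³`. -/
noncomputable def omega (m : ℝ) (k : Fin 3 → ℝ) : ℝ :=
  Real.sqrt ((∑ i, k i ^ 2) + m ^ 2)

/-- The open forward light cone `Γ₊ = {x ∈ ℝ⁴ : x₀ > |x⃗|}`, with `ℝ⁴ = ℝ × ℝ³`. -/
noncomputable def forwardCone : Set (ℝ × (Fin 3 → ℝ)) :=
  {x | Real.sqrt (∑ i, x.2 i ^ 2) < x.1}

/-- The analytic function `f₂(z, w)` whose boundary value is `Δ₊⁽²⁾`. -/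
noncomputable def f₂Ana (m : ℝ) (z w : ℂ × (Fin 3 → ℂ)) : ℂ :=
  ((((2 * Real.pi) ^ 6)⁻¹ : ℝ) : ℂ) *
    ∫ kp : (Fin 3 → ℝ) × (Fin 3 → ℝ),
      Complex.exp (-Complex.I * (omega m kp.1 : ℂ) * z.1 +
          Complex.I * ∑ i, (kp.1 i : ℂ) * z.2 i) *
        Complex.exp (-Complex.I * (omega m kp.2 : ℂ) * w.1 +
          Complex.I * ∑ i, (kp.2 i : ℂ) * w.2 i) /
        (4 * (omega m kp.1 : ℂ) * (omega m kp.2 : ℂ))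

/-- The complex point `x − i t η ∈ ℂ⁴` for `x, η ∈ ℝ⁴`, `t ∈ ℝ`. -/
noncomputable def cpt (x η : ℝ × (Fin 3 → ℝ)) (t : ℝ) : ℂ × (Fin 3 → ℂ) :=
  ((x.1 : ℂ) - Complex.I * (t : ℂ) * (η.1 : ℂ),
    fun i => (x.2 i : ℂ) - Complex.I * (t : ℂ) * (η.2 i : ℂ))

/-- The twofold tensor product `Δ₊⁽²⁾` of two-point functions, as a functional on
functions on `ℝ⁸ = ℝ⁴ × ℝ⁴`. -/
noncomputable def twoPointSq (m : ℝ)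
    (g : ((ℝ × (Fin 3 → ℝ)) × (ℝ × (Fin 3 → ℝ))) → ℂ) : ℂ :=
  ((((2 * Real.pi) ^ 6)⁻¹ : ℝ) : ℂ) *
    ∫ kp : (Fin 3 → ℝ) × (Fin 3 → ℝ),
      (((4 * omega m kp.1 * omega m kp.2)⁻¹ : ℝ) : ℂ) *
        ∫ xy : (ℝ × (Fin 3 → ℝ)) × (ℝ × (Fin 3 → ℝ)),
          g xy * Complex.exp
            (-Complex.I * ((omega m kp.1 : ℂ) * (xy.1.1 : ℂ) + (omega m kp.2 : ℂ) * (xy.2.1 : ℂ)) +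
              Complex.I * ((∑ i, (kp.1 i : ℂ) * (xy.1.2 i : ℂ)) +
                ∑ i, (kp.2 i : ℂ) * (xy.2.2 i : ℂ)))

lemma continuous_omega (m : ℝ) : Continuous (omega m) := by
  unfold omega
  fun_prop

lemma omega_pos {m : ℝ} (hm : 0 < m) (k : Fin 3 → ℝ) : 0 < omega m k :=
  Real.sqrt_pos.2 <| add_pos_of_nonneg_of_pos (Finset.sum_nonneg fun _ _ => sq_nonneg _)
    (by positivity)

lemma le_omega (m : ℝ) (k : Fin 3 → ℝ) : m ≤ omega m k := by
  refine Real.le_sqrt_of_sq_le ?_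
  have : 0 ≤ ∑ i, k i ^ 2 := Finset.sum_nonneg fun _ _ => sq_nonneg _
  linarith

lemma norm_le_sqrt_sum_sq (k : Fin 3 → ℝ) : ‖k‖ ≤ Real.sqrt (∑ i, k i ^ 2) := by
  refine (pi_norm_le_iff_of_nonneg (Real.sqrt_nonneg _)).2 fun i => ?_
  refine Real.le_sqrt_of_sq_le ?_
  rw [Real.norm_eq_abs, sq_abs]
  exact Finset.single_le_sum (f := fun i => k i ^ 2) (fun _ _ => sq_nonneg _) (Finset.mem_univ i)

/-- The Lorentz product of an on-shell momentum with a forward timelike vector dominates the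
spatial momentum. -/
lemma mul_norm_le_energy_pairing (m : ℝ) {η : ℝ × (Fin 3 → ℝ)} (hη : η ∈ forwardCone)
    (k : Fin 3 → ℝ) :
    (η.1 - Real.sqrt (∑ i, η.2 i ^ 2)) * ‖k‖ ≤ omega m k * η.1 - ∑ i, k i * η.2 i := by
  have h0 : Real.sqrt (∑ i, η.2 i ^ 2) < η.1 := hη
  have h1 := Real.sum_mul_le_sqrt_mul_sqrt Finset.univ k η.2
  have h2 : Real.sqrt (∑ i, k i ^ 2) ≤ omega m k :=
    Real.sqrt_le_sqrt (le_add_of_nonneg_right (sq_nonneg m))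
  have h3 := norm_le_sqrt_sum_sq k
  have h4 := Real.sqrt_nonneg (∑ i, η.2 i ^ 2)
  nlinarith [mul_le_mul_of_nonneg_right h2 (h4.trans h0.le),
    mul_le_mul_of_nonneg_left h3 (sub_nonneg.2 h0.le)]

/-- The factor by which an imaginary shift `-i t η` damps the plane wave of momentum `k`. -/
noncomputable def damping (m : ℝ) (η : ℝ × (Fin 3 → ℝ)) (t : ℝ) (k : Fin 3 → ℝ) : ℝ :=
  Real.exp (-(t * (omega m k * η.1 - ∑ i, k i * η.2 i)))

lemma continuous_damping (m : ℝ) (η : ℝ × (Fin 3 → ℝ)) (t : ℝ) :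
    Continuous (damping m η t) := by
  have := continuous_omega m
  unfold damping
  fun_prop

lemma damping_nonneg (m : ℝ) (η : ℝ × (Fin 3 → ℝ)) (t : ℝ) (k : Fin 3 → ℝ) :
    0 ≤ damping m η t k := (Real.exp_pos _).le

lemma damping_le_exp (m : ℝ) {η : ℝ × (Fin 3 → ℝ)} (hη : η ∈ forwardCone) {t : ℝ}
    (ht : 0 ≤ t) (k : Fin 3 → ℝ) :
    damping m η t k ≤ Real.exp (-(t * (η.1 - Real.sqrt (∑ i, η.2 i ^ 2)) * ‖k‖)) := by
  refine Real.exp_le_exp.2 (neg_le_neg ?_)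
  rw [mul_assoc]
  exact mul_le_mul_of_nonneg_left (mul_norm_le_energy_pairing m hη k) ht

lemma damping_le_one (m : ℝ) {η : ℝ × (Fin 3 → ℝ)} (hη : η ∈ forwardCone) {t : ℝ}
    (ht : 0 ≤ t) (k : Fin 3 → ℝ) : damping m η t k ≤ 1 := by
  have h0 : Real.sqrt (∑ i, η.2 i ^ 2) < η.1 := hη
  refine (damping_le_exp m hη ht k).trans (Real.exp_le_one_iff.2 (neg_nonpos.2 ?_))
  exact mul_nonneg (mul_nonneg ht (sub_nonneg.2 h0.le)) (norm_nonneg _)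

lemma tendsto_damping (m : ℝ) (η : ℝ × (Fin 3 → ℝ)) (k : Fin 3 → ℝ) :
    Filter.Tendsto (fun t => damping m η t k) (nhdsWithin 0 (Set.Ioi 0)) (nhds 1) := by
  have h : Continuous fun t => damping m η t k := by
    unfold damping
    fun_prop
  have := h.tendsto 0
  simp only [damping, zero_mul, neg_zero, Real.exp_zero] at this
  exact this.mono_left nhdsWithin_le_nhds

lemma integrable_exp_neg_mul_norm {E : Type*} [NormedAddCommGroup E] [NormedSpace ℝ E]
    [FiniteDimensional ℝ E] [MeasurableSpace E] [BorelSpace E] (μ : Measure E)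
    [μ.IsAddHaarMeasure] {c : ℝ} (hc : 0 < c) :
    Integrable (fun x : E => Real.exp (-(c * ‖x‖))) μ := by
  set n := Module.finrank ℝ E + 1 with hn
  have hr : (Module.finrank ℝ E : ℝ) < (n : ℝ) := by exact_mod_cast Nat.lt_succ_self _
  refine ((integrable_one_add_norm (μ := μ) hr).const_mul
    (Real.exp c * n.factorial / c ^ n)).mono' (by fun_prop) (.of_forall fun x => ?_)
  have hx : 0 < 1 + ‖x‖ := by positivity
  have h := Real.pow_div_factorial_le_exp (c * (1 + ‖x‖)) (by positivity) n
  rw [Real.norm_of_nonneg (Real.exp_pos _).le, Real.rpow_neg hx.le, Real.rpow_natCast,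
    Real.exp_neg, ← div_eq_mul_inv, div_div, inv_eq_one_div,
    div_le_div_iff₀ (Real.exp_pos _) (by positivity)]
  rw [div_le_iff₀ (by positivity), mul_pow, mul_add, Real.exp_add, mul_one] at h
  linarith

lemma integrable_damping (m : ℝ) {η : ℝ × (Fin 3 → ℝ)} (hη : η ∈ forwardCone) {t : ℝ}
    (ht : 0 < t) : Integrable (damping m η t) := by
  refine (integrable_exp_neg_mul_norm volume (mul_pos ht (sub_pos.2 hη))).mono'
    (continuous_damping m η t).aestronglyMeasurable (.of_forall fun k => ?_)
  rw [Real.norm_of_nonneg (damping_nonneg _ _ _ _)]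
  exact damping_le_exp m hη ht.le k

/-- The Fourier transform of a Schwartz function decays rapidly on the dual space. -/
lemma exists_pow_mul_norm_integral_exp_le {V : Type*} [NormedAddCommGroup V] [NormedSpace ℝ V]
    [FiniteDimensional ℝ V] [MeasurableSpace V] [BorelSpace V] (μ : Measure V)
    [μ.IsAddHaarMeasure] (g : SchwartzMap V ℂ) (n : ℕ) :
    ∃ C : ℝ, ∀ (φ : V →L[ℝ] ℝ) (v : V), ‖v‖ ≤ 1 →
      |φ v| ^ n * ‖∫ x, g x * Complex.exp (-Complex.I * (φ x : ℝ)) ∂μ‖ ≤ C := by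
  set S : ℝ := ∑ p ∈ Finset.range (0 + 1) ×ˢ Finset.range (n + 1),
    ∫ v, ‖v‖ ^ p.1 * ‖iteratedFDeriv ℝ p.2 g v‖ ∂μ with hS
  have hS0 : 0 ≤ S := Finset.sum_nonneg fun _ _ => integral_nonneg fun _ => by positivity
  refine ⟨(2 * Real.pi) ^ n * (2 ^ n * S), fun φ v hv => ?_⟩
  have h := VectorFourier.pow_mul_norm_iteratedFDeriv_fourierIntegral_le
    (ContinuousLinearMap.id ℝ (V →L[ℝ] ℝ)).flip (μ := μ) (K := ⊤) (N := ⊤) (g.smooth ⊤)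
    (fun k n _ _ => g.integrable_pow_mul_iteratedFDeriv μ k n) (k := 0) (n := n) le_top le_top v
    ((2 * Real.pi)⁻¹ • φ)
  have hF : VectorFourier.fourierIntegral Real.fourierChar μ
      (ContinuousLinearMap.id ℝ (V →L[ℝ] ℝ)).flip.toLinearMap₁₂ g ((2 * Real.pi)⁻¹ • φ) =
      ∫ x, g x * Complex.exp (-Complex.I * (φ x : ℝ)) ∂μ := by
    refine integral_congr_ae (.of_forall fun x => ?_)
    simp only [Circle.smul_def, Real.fourierChar_apply, smul_eq_mul]
    rw [mul_comm]
    congr 2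
    simp
    field_simp
  rw [norm_iteratedFDeriv_zero, hF] at h
  simp only [ContinuousLinearMap.flip_apply, ContinuousLinearMap.id_apply,
    _root_.smul_apply, smul_eq_mul, abs_mul, mul_pow, pow_zero, mul_one,
    Nat.cast_zero, mul_zero, zero_add] at h
  rw [abs_of_pos (by positivity), inv_pow, mul_assoc, inv_mul_le_iff₀ (by positivity)] at h
  refine h.trans ?_
  gcongr ?_ * ?_
  rw [mul_assoc]
  exact mul_le_of_le_one_left (by positivity) (pow_le_one₀ (norm_nonneg _) hv)

/-- Minus the phase of the two-particle plane wave with momenta `k, p`, as a linear form on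
`ℝ⁴ × ℝ⁴`. -/
noncomputable def onShellForm (m : ℝ) (kp : (Fin 3 → ℝ) × (Fin 3 → ℝ)) :
    ((ℝ × (Fin 3 → ℝ)) × (ℝ × (Fin 3 → ℝ))) →L[ℝ] ℝ :=
  LinearMap.toContinuousLinearMap
    { toFun := fun xy => omega m kp.1 * xy.1.1 + omega m kp.2 * xy.2.1
        - ((∑ i, kp.1 i * xy.1.2 i) + ∑ i, kp.2 i * xy.2.2 i)
      map_add' := fun x y => by
        simp only [Prod.fst_add, Prod.snd_add, Pi.add_apply, mul_add, Finset.sum_add_distrib]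
        ring
      map_smul' := fun c x => by
        simp only [Prod.smul_fst, Prod.smul_snd, Pi.smul_apply, smul_eq_mul, RingHom.id_apply,
          mul_left_comm _ c, ← Finset.mul_sum]
        ring }

lemma onShellForm_apply (m : ℝ) (kp : (Fin 3 → ℝ) × (Fin 3 → ℝ))
    (xy : (ℝ × (Fin 3 → ℝ)) × (ℝ × (Fin 3 → ℝ))) :
    onShellForm m kp xy = omega m kp.1 * xy.1.1 + omega m kp.2 * xy.2.1
        - ((∑ i, kp.1 i * xy.1.2 i) + ∑ i, kp.2 i * xy.2.2 i) := rfl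

lemma continuous_onShellForm_uncurry (m : ℝ) :
    Continuous fun z : ((ℝ × (Fin 3 → ℝ)) × (ℝ × (Fin 3 → ℝ))) ×
      ((Fin 3 → ℝ) × (Fin 3 → ℝ)) => onShellForm m z.2 z.1 := by
  have := continuous_omega m
  simp only [onShellForm_apply]
  fun_prop

lemma exists_norm_le_abs_onShellForm (m : ℝ) (kp : (Fin 3 → ℝ) × (Fin 3 → ℝ)) :
    ∃ v, ‖v‖ ≤ 1 ∧ ‖kp‖ ≤ |onShellForm m kp v| := by
  have key (k : Fin 3 → ℝ) : ∃ i, ‖k‖ ≤ |k i| := by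
    obtain ⟨i, -, hi⟩ := Finset.exists_max_image Finset.univ (fun i => ‖k i‖)
      Finset.univ_nonempty
    exact ⟨i, (pi_norm_le_iff_of_nonneg (norm_nonneg _)).2 fun j => hi j (Finset.mem_univ j)⟩
  have single_le (i : Fin 3) : ‖(Pi.single i 1 : Fin 3 → ℝ)‖ ≤ 1 := by
    refine (pi_norm_le_iff_of_nonneg zero_le_one).2 fun j => ?_
    rw [Pi.single_apply]
    split_ifs <;> simp
  rcases le_total ‖kp.1‖ ‖kp.2‖ with h | h
  · obtain ⟨i, hi⟩ := key kp.2
    refine ⟨((0, 0), (0, Pi.single i 1)), by simpa [Prod.norm_def] using single_le i, ?_⟩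
    rw [Prod.norm_def, max_eq_right h]
    simpa [onShellForm_apply, Pi.single_apply] using hi
  · obtain ⟨i, hi⟩ := key kp.1
    refine ⟨((0, Pi.single i 1), (0, 0)), by simpa [Prod.norm_def] using single_le i, ?_⟩
    rw [Prod.norm_def, max_eq_left h]
    simpa [onShellForm_apply, Pi.single_apply] using hi

instance isAddHaarMeasure_volume_minkowski_prod :
    (volume : Measure ((ℝ × (Fin 3 → ℝ)) × (ℝ × (Fin 3 → ℝ)))).IsAddHaarMeasure :=
  haveI : ((volume : Measure ℝ).prod (volume : Measure (Fin 3 → ℝ))).IsAddHaarMeasure :=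
    Measure.prod.instIsAddHaarMeasure _ _
  Measure.prod.instIsAddHaarMeasure ((volume : Measure ℝ).prod (volume : Measure (Fin 3 → ℝ)))
    ((volume : Measure ℝ).prod (volume : Measure (Fin 3 → ℝ)))

instance isAddHaarMeasure_volume_momentum_prod :
    (volume : Measure ((Fin 3 → ℝ) × (Fin 3 → ℝ))).IsAddHaarMeasure :=
  Measure.prod.instIsAddHaarMeasure (volume : Measure (Fin 3 → ℝ)) (volume : Measure (Fin 3 → ℝ))

/-- The Fourier transform of `g` restricted to the product of two mass shells. -/
noncomputable def onShellFourier (m : ℝ)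
    (g : ((ℝ × (Fin 3 → ℝ)) × (ℝ × (Fin 3 → ℝ))) → ℂ) (kp : (Fin 3 → ℝ) × (Fin 3 → ℝ)) : ℂ :=
  ∫ xy, g xy * Complex.exp (-Complex.I * (onShellForm m kp xy : ℝ))

lemma norm_exp_neg_I_mul (x : ℝ) : ‖Complex.exp (-Complex.I * (x : ℝ))‖ = 1 := by
  simp [Complex.norm_exp]

lemma aestronglyMeasurable_onShellFourier (m : ℝ)
    (g : SchwartzMap ((ℝ × (Fin 3 → ℝ)) × (ℝ × (Fin 3 → ℝ))) ℂ) :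
    AEStronglyMeasurable (onShellFourier m g) := by
  have h : Continuous fun z : ((ℝ × (Fin 3 → ℝ)) × (ℝ × (Fin 3 → ℝ))) ×
      ((Fin 3 → ℝ) × (Fin 3 → ℝ)) =>
      g z.1 * Complex.exp (-Complex.I * (onShellForm m z.2 z.1 : ℝ)) := by
    have := continuous_onShellForm_uncurry m
    have := g.continuous
    fun_prop
  exact (h.stronglyMeasurable.integral_prod_left' (μ := volume)).aestronglyMeasurable

lemma integrable_onShellFourier (m : ℝ)
    (g : SchwartzMap ((ℝ × (Fin 3 → ℝ)) × (ℝ × (Fin 3 → ℝ))) ℂ) :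
    Integrable (onShellFourier m g) := by
  obtain ⟨C₀, h₀⟩ := exists_pow_mul_norm_integral_exp_le volume g 0
  obtain ⟨C₁, h₁⟩ := exists_pow_mul_norm_integral_exp_le volume g 7
  have hr : (Module.finrank ℝ ((Fin 3 → ℝ) × (Fin 3 → ℝ)) : ℝ) < (7 : ℕ) := by
    norm_num [Module.finrank_prod]
  refine ((integrable_one_add_norm hr).const_mul (2 ^ 7 * (C₀ + C₁))).mono'
    (aestronglyMeasurable_onShellFourier m g) (.of_forall fun kp => ?_)
  obtain ⟨v, hv, hkp⟩ := exists_norm_le_abs_onShellForm m kp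
  have e₀ := h₀ (onShellForm m kp) v hv
  have e₁ := h₁ (onShellForm m kp) v hv
  rw [pow_zero, one_mul] at e₀
  have e₂ : ‖kp‖ ^ 7 * ‖onShellFourier m g kp‖ ≤ C₁ :=
    (mul_le_mul_of_nonneg_right (pow_le_pow_left₀ (norm_nonneg _) hkp 7) (norm_nonneg _)).trans e₁
  have hx : 0 < 1 + ‖kp‖ := by positivity
  rw [Real.rpow_neg hx.le, Real.rpow_natCast, ← div_eq_mul_inv, le_div_iff₀ (by positivity)]
  have e₃ : (1 + ‖kp‖) ^ 7 ≤ 2 ^ 7 * (1 + ‖kp‖ ^ 7) := by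
    have := add_pow_le zero_le_one (norm_nonneg kp) 7
    norm_num at this ⊢
    nlinarith [pow_nonneg (norm_nonneg kp) 7]
  calc ‖onShellFourier m g kp‖ * (1 + ‖kp‖) ^ 7
      ≤ ‖onShellFourier m g kp‖ * (2 ^ 7 * (1 + ‖kp‖ ^ 7)) := by gcongr
    _ = 2 ^ 7 * (‖onShellFourier m g kp‖ + ‖kp‖ ^ 7 * ‖onShellFourier m g kp‖) := by ring
    _ ≤ 2 ^ 7 * (C₀ + C₁) := by gcongr; exact e₀

lemma twoPointSq_eq (m : ℝ) (g : ((ℝ × (Fin 3 → ℝ)) × (ℝ × (Fin 3 → ℝ))) → ℂ) :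
    twoPointSq m g = ((((2 * Real.pi) ^ 6)⁻¹ : ℝ) : ℂ) *
      ∫ kp : (Fin 3 → ℝ) × (Fin 3 → ℝ),
        (((4 * omega m kp.1 * omega m kp.2)⁻¹ : ℝ) : ℂ) * onShellFourier m g kp := by
  simp only [twoPointSq, onShellFourier, onShellForm_apply]
  congr! 7
  push_cast
  ring_nf

lemma f₂Ana_cpt_eq (m : ℝ) (η η' x y : ℝ × (Fin 3 → ℝ)) (t : ℝ) :
    f₂Ana m (cpt x η t) (cpt y η' t) = ((((2 * Real.pi) ^ 6)⁻¹ : ℝ) : ℂ) *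
      ∫ kp : (Fin 3 → ℝ) × (Fin 3 → ℝ),
        Complex.exp (-Complex.I * (onShellForm m kp (x, y) : ℝ)) *
          ((((4 * omega m kp.1 * omega m kp.2)⁻¹ : ℝ) : ℂ) *
            ((damping m η t kp.1 * damping m η' t kp.2 : ℝ) : ℂ)) := by
  have hexp (k : Fin 3 → ℝ) (x η : ℝ × (Fin 3 → ℝ)) :
      Complex.exp (-Complex.I * (omega m k : ℂ) * (cpt x η t).1 +
        Complex.I * ∑ i, (k i : ℂ) * (cpt x η t).2 i) =
      Complex.exp (-Complex.I * ((omega m k * x.1 - ∑ i, k i * x.2 i : ℝ) : ℂ)) *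
        (damping m η t k : ℂ) := by
    rw [damping, Complex.ofReal_exp, ← Complex.exp_add]
    congr 1
    simp only [cpt, mul_sub, Finset.sum_sub_distrib, Complex.ofReal_sub, Complex.ofReal_mul,
      Complex.ofReal_neg, Complex.ofReal_sum]
    have : ∑ i, (k i : ℂ) * (Complex.I * (t : ℂ) * (η.2 i : ℂ)) =
        Complex.I * t * ∑ i, (k i : ℂ) * (η.2 i : ℂ) := by
      rw [Finset.mul_sum]
      exact Finset.sum_congr rfl fun _ _ => by ring
    rw [this]
    linear_combination (t * omega m k * η.1 - t * ∑ i, (k i : ℂ) * (η.2 i : ℂ)) * Complex.I_sq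
  have hsplit (kp : (Fin 3 → ℝ) × (Fin 3 → ℝ)) :
      Complex.exp (-Complex.I * (onShellForm m kp (x, y) : ℝ)) =
      Complex.exp (-Complex.I * ((omega m kp.1 * x.1 - ∑ i, kp.1 i * x.2 i : ℝ) : ℂ)) *
      Complex.exp (-Complex.I * ((omega m kp.2 * y.1 - ∑ i, kp.2 i * y.2 i : ℝ) : ℂ)) := by
    rw [← Complex.exp_add, onShellForm_apply]
    congr 1
    push_cast
    ring
  simp only [f₂Ana, hexp, hsplit]
  congr! 3
  push_cast
  rw [div_eq_mul_inv]
  ring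

lemma norm_inv_energies_le {m : ℝ} (hm : 0 < m) (kp : (Fin 3 → ℝ) × (Fin 3 → ℝ)) :
    ‖(((4 * omega m kp.1 * omega m kp.2)⁻¹ : ℝ) : ℂ)‖ ≤ (4 * m * m)⁻¹ := by
  have h1 := le_omega m kp.1
  have h2 := le_omega m kp.2
  have h3 := omega_pos hm kp.1
  have h4 := omega_pos hm kp.2
  rw [Complex.norm_real, Real.norm_of_nonneg (by positivity)]
  gcongr

lemma continuous_inv_energies {m : ℝ} (hm : 0 < m) :
    Continuous fun kp : (Fin 3 → ℝ) × (Fin 3 → ℝ) =>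
      (((4 * omega m kp.1 * omega m kp.2)⁻¹ : ℝ) : ℂ) := by
  have := continuous_omega m
  refine Complex.continuous_ofReal.comp (Continuous.inv₀ (by fun_prop) fun kp => ?_)
  have h3 := omega_pos hm kp.1
  have h4 := omega_pos hm kp.2
  positivity

lemma continuous_damping_mul (m : ℝ) (η η' : ℝ × (Fin 3 → ℝ)) (t : ℝ) :
    Continuous fun kp : (Fin 3 → ℝ) × (Fin 3 → ℝ) =>
      ((damping m η t kp.1 * damping m η' t kp.2 : ℝ) : ℂ) := by
  have := continuous_damping m η t
  have := continuous_damping m η' t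
  fun_prop

/-- Smearing the regularized function amounts to damping the on-shell Fourier transform. -/
lemma integral_f₂Ana_cpt_mul {m : ℝ} (hm : 0 < m)
    {η η' : ℝ × (Fin 3 → ℝ)} (hη : η ∈ forwardCone) (hη' : η' ∈ forwardCone)
    (g : SchwartzMap ((ℝ × (Fin 3 → ℝ)) × (ℝ × (Fin 3 → ℝ))) ℂ) {t : ℝ} (ht : 0 < t) :
    ∫ xy : (ℝ × (Fin 3 → ℝ)) × (ℝ × (Fin 3 → ℝ)),
        f₂Ana m (cpt xy.1 η t) (cpt xy.2 η' t) * g xy =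
      ((((2 * Real.pi) ^ 6)⁻¹ : ℝ) : ℂ) * ∫ kp : (Fin 3 → ℝ) × (Fin 3 → ℝ),
        ((damping m η t kp.1 * damping m η' t kp.2 : ℝ) : ℂ) *
          ((((4 * omega m kp.1 * omega m kp.2)⁻¹ : ℝ) : ℂ) * onShellFourier m g kp) := by
  set w : (Fin 3 → ℝ) × (Fin 3 → ℝ) → ℂ := fun kp =>
    (((4 * omega m kp.1 * omega m kp.2)⁻¹ : ℝ) : ℂ) *
      ((damping m η t kp.1 * damping m η' t kp.2 : ℝ) : ℂ) with hw
  have hw_int : Integrable w := by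
    refine Integrable.bdd_mul (c := (4 * m * m)⁻¹) ?_
      (continuous_inv_energies hm).aestronglyMeasurable
      (.of_forall fun kp => norm_inv_energies_le hm kp)
    exact ((integrable_damping m hη ht).mul_prod (integrable_damping m hη' ht)).ofReal
  have h_int : Integrable (Function.uncurry
      fun (xy : (ℝ × (Fin 3 → ℝ)) × (ℝ × (Fin 3 → ℝ))) (kp : (Fin 3 → ℝ) × (Fin 3 → ℝ)) =>
        Complex.exp (-Complex.I * (onShellForm m kp xy : ℝ)) * (g xy * w kp))
      (volume.prod volume) := by
    refine Integrable.bdd_mul (c := 1) (g.integrable.mul_prod hw_int) ?_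
      (.of_forall fun z => (norm_exp_neg_I_mul _).le)
    have := continuous_onShellForm_uncurry m
    exact Continuous.aestronglyMeasurable (by fun_prop)
  simp only [f₂Ana_cpt_eq, mul_assoc]
  rw [integral_const_mul]
  congr 1
  calc _ = ∫ xy, ∫ kp, Complex.exp (-Complex.I * (onShellForm m kp xy : ℝ)) * (g xy * w kp) := by
        refine integral_congr_ae (.of_forall fun xy => ?_)
        simp only
        rw [← integral_mul_const]
        refine integral_congr_ae (.of_forall fun kp => ?_)
        simp only [hw, mul_assoc]
        ring
    _ = ∫ kp, ∫ xy, Complex.exp (-Complex.I * (onShellForm m kp xy : ℝ)) * (g xy * w kp) :=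
        integral_integral_swap h_int
    _ = _ := by
        refine integral_congr_ae (.of_forall fun kp => ?_)
        simp only [onShellFourier]
        rw [← integral_const_mul, ← integral_const_mul]
        refine integral_congr_ae (.of_forall fun xy => ?_)
        simp only [hw]
        push_cast
        ring

/-- `Δ₊⁽²⁾` is the boundary value of `f₂` in the sense of tempered distributions:
for all `η, η′` in the open forward light cone and every Schwartz function `g` on `ℝ⁸`,
`∫∫ f₂(x − itη, y − itη′) g(x,y) dx dy → Δ₊⁽²⁾(g)` as `t → 0⁺`. -/
theorem twoPointSq_boundary_value (m : ℝ) (hm : 0 < m)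
    (η η' : ℝ × (Fin 3 → ℝ)) (hη : η ∈ forwardCone) (hη' : η' ∈ forwardCone)
    (g : SchwartzMap ((ℝ × (Fin 3 → ℝ)) × (ℝ × (Fin 3 → ℝ))) ℂ) :
    Filter.Tendsto (fun t : ℝ =>
        ∫ xy : (ℝ × (Fin 3 → ℝ)) × (ℝ × (Fin 3 → ℝ)),
          f₂Ana m (cpt xy.1 η t) (cpt xy.2 η' t) * g xy)
      (nhdsWithin 0 (Set.Ioi 0)) (nhds (twoPointSq m g)) := by
  rw [twoPointSq_eq]
  have hev : (fun t : ℝ => ((((2 * Real.pi) ^ 6)⁻¹ : ℝ) : ℂ) *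
      ∫ kp : (Fin 3 → ℝ) × (Fin 3 → ℝ),
        ((damping m η t kp.1 * damping m η' t kp.2 : ℝ) : ℂ) *
          ((((4 * omega m kp.1 * omega m kp.2)⁻¹ : ℝ) : ℂ) * onShellFourier m g kp))
      =ᶠ[nhdsWithin 0 (Set.Ioi 0)] fun t : ℝ =>
        ∫ xy : (ℝ × (Fin 3 → ℝ)) × (ℝ × (Fin 3 → ℝ)),
          f₂Ana m (cpt xy.1 η t) (cpt xy.2 η' t) * g xy := by
    filter_upwards [self_mem_nhdsWithin] with t ht
    exact (integral_f₂Ana_cpt_mul hm hη hη' g ht).symm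
  refine Filter.Tendsto.congr' hev (Filter.Tendsto.const_mul _ ?_)
  have h_int : Integrable fun kp : (Fin 3 → ℝ) × (Fin 3 → ℝ) =>
      (((4 * omega m kp.1 * omega m kp.2)⁻¹ : ℝ) : ℂ) * onShellFourier m g kp :=
    (integrable_onShellFourier m g).bdd_mul (c := (4 * m * m)⁻¹)
      (continuous_inv_energies hm).aestronglyMeasurable
      (.of_forall fun kp => norm_inv_energies_le hm kp)
  refine tendsto_integral_filter_of_dominated_convergence _
    (.of_forall fun t => (continuous_damping_mul m η η' t).aestronglyMeasurable.mul
      h_int.aestronglyMeasurable) ?_ h_int.norm (.of_forall fun kp => ?_)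
  · filter_upwards [self_mem_nhdsWithin] with t ht
    refine .of_forall fun kp => ?_
    have ht' : (0 : ℝ) ≤ t := le_of_lt ht
    rw [norm_mul]
    refine mul_le_of_le_one_left (norm_nonneg _) ?_
    rw [Complex.norm_real, Real.norm_of_nonneg
      (mul_nonneg (damping_nonneg _ _ _ _) (damping_nonneg _ _ _ _))]
    exact mul_le_one₀ (damping_le_one m hη ht' _) (damping_nonneg _ _ _ _)
      (damping_le_one m hη' ht' _)
  · have h := (tendsto_damping m η kp.1).mul (tendsto_damping m η' kp.2)
    rw [mul_one] at h
    simpa using h.ofReal.mul_const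
      ((((4 * omega m kp.1 * omega m kp.2)⁻¹ : ℝ) : ℂ) * onShellFourier m g kp)
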